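/- Let n ≥ 1 and λ > 0. For all x, y ∈ B_λ(0) ∩ ℝⁿ₊ with x ≠ y, one has the strict inequality ln(1/|x−y|) − ln(1/|x̄−y|) > ln(1/|x−y^λ|) − ln(1/|x̄−y^λ|), where y^λ := λ² y/|y|² is the inversion of y with respect to the sphere of radius λ centered at the origin; that is, G⁺(x,y) > G⁺(x,y^λ). -/

import Mathlib

open MeasureTheory Real Set Metric

noncomputable section

abbrev E (n : ℕ) := EuclideanSpace ℝ (Fin n)

/-- The last coordinate `xₙ` of a point `x ∈ ℝⁿ` (junk value `0` when `n = 0`). -/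
def lastCoord (n : ℕ) (x : E n) : ℝ :=
  if h : 0 < n then x ⟨n - 1, Nat.sub_lt h Nat.one_pos⟩ else 0

/-- The upper half space `ℝⁿ₊ = {x : xₙ > 0}`. -/
def halfSpace (n : ℕ) : Set (E n) := {x | 0 < lastCoord n x}

/-- The last standard basis vector `eₙ`. -/
def lastBasis (n : ℕ) : E n :=
  if h : 0 < n then EuclideanSpace.single ⟨n - 1, Nat.sub_lt h Nat.one_pos⟩ (1 : ℝ) else 0

/-- The reflection `x̄ = (x₁, …, x_{n−1}, −xₙ)` of `x` across `∂ℝⁿ₊`. -/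
def reflect (n : ℕ) (x : E n) : E n := x - (2 * lastCoord n x) • lastBasis n

/-- The kernel `G⁺(x,y) = C_n (ln(1/|x−y|) − ln(1/|x̄−y|))`, the Green function of
`(−Δ)^{n/2}` on the half space with Navier boundary conditions. -/
def Gplus (n : ℕ) (Cn : ℝ) (x y : E n) : ℝ :=
  Cn * (Real.log (1 / ‖x - y‖) - Real.log (1 / ‖reflect n x - y‖))

/-- The Laplacian `Δu = ∑ᵢ ∂²u/∂xᵢ²`. -/
def lap (n : ℕ) (u : E n → ℝ) (x : E n) : ℝ :=
  ∑ i, fderiv ℝ (fun y => fderiv ℝ u y (EuclideanSpace.single i 1)) x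
    (EuclideanSpace.single i 1)

/-- The iterate `(−Δ)^k u` of the negative Laplacian. -/
def negLapIter (n k : ℕ) (u : E n → ℝ) : E n → ℝ :=
  (fun v x => - lap n v x)^[k] u

lemma inner_lastBasis (n : ℕ) (x : E n) : inner ℝ x (lastBasis n) = lastCoord n x := by
  unfold lastBasis lastCoord
  split_ifs <;> simp [EuclideanSpace.inner_single_right]

lemma norm_reflect_sub_sq (n : ℕ) (hn : 1 ≤ n) (x z : E n) :
    ‖reflect n x - z‖ ^ 2 = ‖x - z‖ ^ 2 + 4 * lastCoord n x * lastCoord n z := by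
  have hone : ‖lastBasis n‖ = 1 := by
    simp [lastBasis, Nat.lt_of_lt_of_le Nat.zero_lt_one hn]
  have hsplit : reflect n x - z = (x - z) - (2 * lastCoord n x) • lastBasis n := by
    unfold reflect
    abel
  rw [hsplit, norm_sub_sq_real, inner_smul_right, inner_sub_left, inner_lastBasis,
    inner_lastBasis, norm_smul, hone, Real.norm_eq_abs, mul_one, sq_abs]
  ring

lemma lastCoord_smul (n : ℕ) (t : ℝ) (y : E n) :
    lastCoord n (t • y) = t * lastCoord n y := by
  unfold lastCoord
  split_ifs <;> simp

lemma log_one_div_sub_lt {a b c d : ℝ} (ha : 0 < a) (hb : 0 < b) (hc : 0 < c) (hd : 0 < d)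
    (h : c ^ 2 * b ^ 2 < a ^ 2 * d ^ 2) :
    Real.log (1 / a) - Real.log (1 / b) < Real.log (1 / c) - Real.log (1 / d) := by
  have hlt : c * b < a * d := by
    refine lt_of_pow_lt_pow_left₀ 2 (by positivity) ?_
    rwa [mul_pow, mul_pow]
  have hlog := Real.log_lt_log (mul_pos hc hb) hlt
  rw [Real.log_mul hc.ne' hb.ne', Real.log_mul ha.ne' hd.ne'] at hlog
  simp only [one_div, Real.log_inv]
  linarith

/-- Replacing `y` by a dilation `t • y` with `1 < t` and `‖x‖² < t ‖y‖²` strictly decreases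
`ln(1/|x−y|) − ln(1/|x̄−y|)`. -/
lemma log_reflect_smul_lt (n : ℕ) (hn : 1 ≤ n) {x y : E n} {t : ℝ} (hx : x ∈ halfSpace n)
    (hy : y ∈ halfSpace n) (hxy : x ≠ y) (ht : 1 < t) (hxt : ‖x‖ ^ 2 < t * ‖y‖ ^ 2) :
    Real.log (1 / ‖x - t • y‖) - Real.log (1 / ‖reflect n x - t • y‖) <
      Real.log (1 / ‖x - y‖) - Real.log (1 / ‖reflect n x - y‖) := by
  have hx0 : 0 < lastCoord n x := hx
  have hy0 : 0 < lastCoord n y := hy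
  have ht0 : 0 < t := one_pos.trans ht
  have hc : 0 < ‖x - y‖ := norm_pos_iff.2 (sub_ne_zero.2 hxy)
  have ha : 0 < ‖x - t • y‖ := by
    refine norm_pos_iff.2 (sub_ne_zero.2 fun h => ?_)
    rw [h, norm_smul, Real.norm_eq_abs, mul_pow, sq_abs] at hxt
    nlinarith [mul_nonneg (mul_pos ht0 (sub_pos.2 ht)).le (sq_nonneg ‖y‖)]
  have hd2 := norm_reflect_sub_sq n hn x y
  have hb2 := norm_reflect_sub_sq n hn x (t • y)
  rw [lastCoord_smul] at hb2
  have hprod : 0 < lastCoord n x * lastCoord n y := mul_pos hx0 hy0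
  have hd : 0 < ‖reflect n x - y‖ := by
    refine (norm_nonneg _).lt_of_ne' fun h => ?_
    rw [h] at hd2
    nlinarith [sq_nonneg ‖x - y‖]
  have hb : 0 < ‖reflect n x - t • y‖ := by
    refine (norm_nonneg _).lt_of_ne' fun h => ?_
    rw [h] at hb2
    nlinarith [sq_nonneg ‖x - t • y‖, mul_pos ht0 hprod]
  refine log_one_div_sub_lt ha hb hc hd ?_
  have hscale : t * ‖x - y‖ ^ 2 < ‖x - t • y‖ ^ 2 := by
    rw [norm_sub_sq_real, norm_sub_sq_real, inner_smul_right, norm_smul, Real.norm_eq_abs,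
      mul_pow, sq_abs]
    nlinarith [mul_pos (sub_pos.2 ht) (sub_pos.2 hxt)]
  rw [hb2, hd2]
  nlinarith [mul_pos hprod (sub_pos.2 hscale)]

/-- **Monotonicity of `G⁺` under inversion in a sphere** (formula (4.2) of the paper).
For `λ > 0` and distinct `x, y ∈ B_λ(0) ∩ ℝⁿ₊`, one has
`ln(1/|x−y|) − ln(1/|x̄−y|) > ln(1/|x−y^λ|) − ln(1/|x̄−y^λ|)` where `y^λ = λ²y/|y|²`;
that is, `G⁺(x,y) > G⁺(x,y^λ)`. -/
theorem Gplus_inversion_lt (n : ℕ) (hn : 1 ≤ n) (Cn lam : ℝ)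
    (hCn : 0 < Cn) (hlam : 0 < lam) :
    ∀ x ∈ Metric.ball (0 : E n) lam ∩ halfSpace n,
    ∀ y ∈ Metric.ball (0 : E n) lam ∩ halfSpace n, x ≠ y →
      (Real.log (1 / ‖x - (lam ^ 2 / ‖y‖ ^ 2) • y‖) -
          Real.log (1 / ‖reflect n x - (lam ^ 2 / ‖y‖ ^ 2) • y‖) <
        Real.log (1 / ‖x - y‖) - Real.log (1 / ‖reflect n x - y‖)) ∧
      Gplus n Cn x ((lam ^ 2 / ‖y‖ ^ 2) • y) < Gplus n Cn x y := by
  rintro x ⟨hxb, hx⟩ y ⟨hyb, hy⟩ hxy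
  rw [mem_ball_zero_iff] at hxb hyb
  have hy_pos : 0 < ‖y‖ := by
    refine norm_pos_iff.2 fun h => ?_
    simp [halfSpace, lastCoord, h] at hy
  have ht : 1 < lam ^ 2 / ‖y‖ ^ 2 := by
    rw [one_lt_div (by positivity)]
    gcongr
  have hxt : ‖x‖ ^ 2 < lam ^ 2 / ‖y‖ ^ 2 * ‖y‖ ^ 2 := by
    rw [div_mul_cancel₀ _ (by positivity)]
    gcongr
  have h := log_reflect_smul_lt n hn hx hy hxy ht hxt
  exact ⟨h, mul_lt_mul_of_pos_left h hCn⟩
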